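/- Let n ≥ 3 be an integer with n ≡ 1 (mod 3), and let T be a perfect tiling subset of G for parameter n. Then for every g ∈ G, the number of elements t ∈ T with t³ = g is at most 2 (i.e., every element of G appears at most 2 times in the multiset T^(3) = {t³ : t ∈ T}). -/

import Mathlib

/-- `T` is a perfect tiling subset of `G` for parameter `n`:
`|G| = 2n²+1`, `|T| = 2n+1`, `e ∈ T`, `T = T⁽⁻¹⁾`, and
`T·T = 2·G + T⁽²⁾ + (2n-2)·e` in the integral group ring `ℤ[G]`. -/
def IsPerfectTilingSubset (n : ℕ) {G : Type} [CommGroup G] [Fintype G] [DecidableEq G]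
    (T : Finset G) : Prop :=
  Fintype.card G = 2 * n ^ 2 + 1 ∧
  T.card = 2 * n + 1 ∧
  (1 : G) ∈ T ∧
  T = T.image (·⁻¹) ∧
  (∑ t ∈ T, MonoidAlgebra.single t (1 : ℤ)) * (∑ t ∈ T, MonoidAlgebra.single t (1 : ℤ))
    = 2 * (∑ g : G, MonoidAlgebra.single g (1 : ℤ))
      + (∑ t ∈ T, MonoidAlgebra.single (t ^ 2) (1 : ℤ))
      + MonoidAlgebra.single (1 : G) (2 * (n : ℤ) - 2)

open Finset in
lemma aux_cube {R ι : Type*} [CommRing R] [DecidableEq ι] (s : Finset ι) (f : ι → R) :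
    ∃ z : R, (∑ i ∈ s, f i) ^ 3 = ∑ i ∈ s, f i ^ 3 + 3 * z := by
  induction s using Finset.induction_on with
  | empty => exact ⟨0, by simp⟩
  | insert a s ha ih =>
    obtain ⟨z, hz⟩ := ih
    refine ⟨z + f a ^ 2 * (∑ i ∈ s, f i) + f a * (∑ i ∈ s, f i) ^ 2, ?_⟩
    rw [sum_insert ha, sum_insert ha]
    linear_combination hz

section aux
open Finset
variable {G : Type} [CommGroup G] [Fintype G] [DecidableEq G]

lemma aux_r (n : ℕ) (T : Finset G) (hT : IsPerfectTilingSubset n T) (x : G) :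
    (∑ s ∈ T, ∑ t ∈ T, if s * t = x then (1 : ℤ) else 0)
      = 2 + (∑ t ∈ T, if t ^ 2 = x then (1 : ℤ) else 0) + if x = 1 then 2 * (n : ℤ) - 2 else 0 := by
  obtain ⟨-, -, -, -, h⟩ := hT
  have h := congrArg (fun z => z.coeff x) h
  have e2 : (2 : MonoidAlgebra ℤ G) = MonoidAlgebra.single 1 2 := rfl
  rw [e2, sum_mul_sum] at h
  simp only [MonoidAlgebra.single_mul_single, MonoidAlgebra.coeff_add,
    MonoidAlgebra.coeff_sum, MonoidAlgebra.coeff_single, Finsupp.add_apply, mul_sum,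
    Finsupp.finsetSum_apply, Finsupp.single_apply, one_mul, mul_one] at h
  rw [h]
  simp [eq_comm]

lemma aux_i (n : ℕ) (hmod : n % 3 = 1) (T : Finset G) (hT : IsPerfectTilingSubset n T) (x : G) :
    ∃ w : ℤ, (∑ s ∈ T, ∑ t ∈ T, if s * t ^ 2 = x then (1 : ℤ) else 0)
      = (∑ t ∈ T, if t ^ 3 = x then (1 : ℤ) else 0) + 3 * w := by
  obtain ⟨-, hc, -, -, h⟩ := hT
  obtain ⟨k, rfl⟩ : ∃ k, n = 3 * k + 1 := ⟨n / 3, by omega⟩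
  obtain ⟨z, hz⟩ := aux_cube T (fun t => MonoidAlgebra.single t (1 : ℤ))
  have hG : (∑ t ∈ T, MonoidAlgebra.single t (1 : ℤ)) * (∑ g : G, MonoidAlgebra.single g (1 : ℤ))
      = 3 * ((2 * k + 1 : ℕ) * ∑ g : G, MonoidAlgebra.single g (1 : ℤ)) := by
    rw [sum_mul]
    have : ∀ t ∈ T, MonoidAlgebra.single t (1 : ℤ) * (∑ g : G, MonoidAlgebra.single g (1 : ℤ))
        = ∑ g : G, MonoidAlgebra.single g (1 : ℤ) := by
      intro t _
      rw [mul_sum]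
      simp only [MonoidAlgebra.single_mul_single, mul_one]
      exact Equiv.sum_comp (Equiv.mulLeft t) (fun g => MonoidAlgebra.single g (1 : ℤ))
    rw [sum_congr rfl this, sum_const, hc, nsmul_eq_mul]
    push_cast
    ring
  have h1 : MonoidAlgebra.single (1 : G) (2 * ((3 * k + 1 : ℕ) : ℤ) - 2)
      = 3 * MonoidAlgebra.single (1 : G) (2 * (k : ℤ)) := by
    have e3 : (3 : MonoidAlgebra ℤ G) = MonoidAlgebra.single 1 3 := rfl
    rw [e3, MonoidAlgebra.single_mul_single]
    congr 1
    · simp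
    · push_cast; ring
  rw [h1] at h
  obtain ⟨w, hw⟩ : ∃ w : MonoidAlgebra ℤ G,
      (∑ t ∈ T, MonoidAlgebra.single t (1 : ℤ)) * (∑ t ∈ T, MonoidAlgebra.single (t ^ 2) (1 : ℤ))
        = ∑ t ∈ T, MonoidAlgebra.single (t ^ 3) (1 : ℤ) + MonoidAlgebra.single 1 3 * w := by
    have e3 : MonoidAlgebra.single 1 3 = (3 : MonoidAlgebra ℤ G) := rfl
    rw [e3]
    simp only [MonoidAlgebra.single_pow, one_pow] at hz
    refine ⟨z - 2 * ((2 * k + 1 : ℕ) * ∑ g : G, MonoidAlgebra.single g (1 : ℤ))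
      - (∑ t ∈ T, MonoidAlgebra.single t (1 : ℤ)) * MonoidAlgebra.single (1 : G) (2 * (k : ℤ)), ?_⟩
    linear_combination hz - (∑ t ∈ T, MonoidAlgebra.single t (1 : ℤ)) * h - 2 * hG
  refine ⟨w.coeff x, ?_⟩
  have h := congrArg (fun z => z.coeff x) hw
  simp only [sum_mul_sum, MonoidAlgebra.single_mul_single, MonoidAlgebra.coeff_add,
    MonoidAlgebra.coeff_sum, MonoidAlgebra.coeff_single, Finsupp.add_apply,
    MonoidAlgebra.coeff_single_one_mul,
    Finsupp.finsetSum_apply, Finsupp.single_apply, mul_one] at h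
  exact h

lemma aux_sq (n : ℕ) (T : Finset G) (hT : IsPerfectTilingSubset n T) {a b : G}
    (h : a ^ 2 = b ^ 2) : a = b := by
  have hc : (Nat.card G).Coprime 2 := by
    rw [Nat.card_eq_fintype_card, hT.1, Nat.coprime_two_right, Nat.odd_iff]; omega
  exact (powCoprime hc).injective h

lemma aux_inv (n : ℕ) (T : Finset G) (hT : IsPerfectTilingSubset n T) {a : G} :
    a⁻¹ ∈ T ↔ a ∈ T := by
  have : ∀ b ∈ T, b⁻¹ ∈ T := fun b hb => by
    rw [hT.2.2.2.1]; exact mem_image_of_mem _ hb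
  exact ⟨fun h => by simpa using this _ h, this a⟩

/-- uniqueness of representations by distinct elements -/
lemma aux_uniq (n : ℕ) (T : Finset G) (hT : IsPerfectTilingSubset n T) {a b c d : G}
    (ha : a ∈ T) (hb : b ∈ T) (hc : c ∈ T) (hd : d ∈ T) (hab : a ≠ b) (hcd : c ≠ d)
    (h1 : a * b ≠ 1) (h : a * b = c * d) : (a = c ∧ b = d) ∨ (a = d ∧ b = c) := by
  have hr := aux_r n T hT (a * b)
  rw [if_neg h1, add_zero] at hr
  have hD : (∑ s ∈ T, ∑ t ∈ T, if s = t ∧ s * t = a * b then (1 : ℤ) else 0)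
      = ∑ t ∈ T, if t ^ 2 = a * b then (1 : ℤ) else 0 := by
    refine sum_congr rfl fun s hs => ?_
    rw [sum_eq_single s]
    · simp [pow_two]
    · intro t _ hts; simp [hts.symm]
    · exact fun h => absurd hs h
  have hO : (∑ s ∈ T, ∑ t ∈ T, if s ≠ t ∧ s * t = a * b then (1 : ℤ) else 0) = 2 := by
    have : (∑ s ∈ T, ∑ t ∈ T, if s * t = a * b then (1 : ℤ) else 0)
       = (∑ s ∈ T, ∑ t ∈ T, if s = t ∧ s * t = a * b then (1 : ℤ) else 0) +
         (∑ s ∈ T, ∑ t ∈ T, if s ≠ t ∧ s * t = a * b then (1 : ℤ) else 0) := by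
      simp only [← sum_add_distrib]
      refine sum_congr rfl fun s _ => sum_congr rfl fun t _ => ?_
      by_cases h : s = t <;> simp [h]
    linarith
  rw [← sum_product' T T (fun s t => if s ≠ t ∧ s * t = a * b then (1 : ℤ) else 0),
    ← sum_filter, sum_const, nsmul_eq_mul, mul_one] at hO
  have hO : #{p ∈ T ×ˢ T | p.1 ≠ p.2 ∧ p.1 * p.2 = a * b} = 2 := by exact_mod_cast hO
  have hs : ({(a, b), (b, a)} : Finset (G × G)) ⊆
      {p ∈ T ×ˢ T | p.1 ≠ p.2 ∧ p.1 * p.2 = a * b} := by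
    intro p hp
    simp only [mem_insert, mem_singleton] at hp
    rcases hp with rfl | rfl
    · simp [ha, hb, hab]
    · simp [ha, hb, hab.symm, mul_comm]
  have he := eq_of_subset_of_card_le hs (by
    rw [hO, card_pair]; simp [hab])
  have hm : (c, d) ∈ ({(a, b), (b, a)} : Finset (G × G)) := by
    rw [he]; simp [hc, hd, hcd, h]
  simp only [mem_insert, mem_singleton, Prod.mk.injEq] at hm
  rcases hm with ⟨h1, h2⟩ | ⟨h1, h2⟩
  · exact Or.inl ⟨h1.symm, h2.symm⟩
  · exact Or.inr ⟨h2.symm, h1.symm⟩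

lemma aux_sqT (n : ℕ) (T : Finset G) (hT : IsPerfectTilingSubset n T) {t : G}
    (ht : t ∈ T) : t ^ 2 ∈ T ↔ t ^ 3 = 1 := by
  have h1 := hT.2.2.1
  have hi := (aux_inv n T hT).2 ht
  constructor
  · intro h
    by_contra h3
    have ht1 : t ≠ 1 := by rintro rfl; simp at h3
    have := aux_uniq n T hT h1 ht hi h ht1.symm
      (by intro h; apply h3; rw [pow_succ, ← h]; simp)
      (by simpa using ht1) (by simp [pow_two])
    rcases this with ⟨h, -⟩ | ⟨-, h⟩
    · exact ht1 (by simpa using h.symm)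
    · apply ht1
      apply aux_sq n T hT
      rw [pow_two]; nth_rewrite 1 [h]; simp
  · intro h
    have : t ^ 2 = t⁻¹ := by rw [eq_inv_iff_mul_eq_one, ← pow_succ, h]
    rwa [this]

/-- The value at identity. -/
lemma aux_i1 (n : ℕ) (T : Finset G) (hT : IsPerfectTilingSubset n T) :
    (∑ s ∈ T, ∑ t ∈ T, if s * t ^ 2 = 1 then (1 : ℤ) else 0)
      = ∑ t ∈ T, if t ^ 3 = 1 then (1 : ℤ) else 0 := by
  rw [sum_comm]
  refine sum_congr rfl fun t ht => ?_
  by_cases h : t ^ 3 = 1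
  · rw [sum_eq_single t]
    · simp [← pow_succ', h]
    · intro s _ hst
      rw [if_neg]
      intro h'
      apply hst
      rw [pow_succ', ← h'] at h
      exact (mul_right_cancel h).symm
    · exact fun h => absurd ht h
  · rw [if_neg h]
    refine sum_eq_zero fun s hs => if_neg fun h' => h ?_
    rw [← aux_sqT n T hT ht, ← aux_inv n T hT]
    rwa [← eq_inv_iff_mul_eq_one.2 h']

/-- The value on nonidentity elements of T. -/
lemma aux_ia (n : ℕ) (T : Finset G) (hT : IsPerfectTilingSubset n T) {a : G} (ha : a ∈ T)
    (ha1 : a ≠ 1) :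
    (∑ s ∈ T, ∑ t ∈ T, if s * t ^ 2 = a then (1 : ℤ) else 0)
      = (∑ t ∈ T, if t ^ 3 = a then (1 : ℤ) else 0) + 2 + if a ^ 3 ∈ T then 1 else 0 := by
  have h1 := hT.2.2.1
  have hi := (aux_inv n T hT).2 ha
  have hai : a ≠ a⁻¹ := by
    intro h; apply ha1; apply aux_sq n T hT
    rw [pow_two]; nth_rewrite 1 [h]; simp
  have hai1 : a⁻¹ ≠ 1 := by simpa using ha1
  have key : ∀ t ∈ T, (∑ s ∈ T, if s * t ^ 2 = a then (1 : ℤ) else 0)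
      = (if t ^ 3 = a then 1 else 0) + (if t = 1 then 1 else 0) + (if t = a then 1 else 0)
        + (if t = a⁻¹ then (if a ^ 3 ∈ T then 1 else 0) else 0) := by
    intro t ht
    have e : (∑ s ∈ T, if s * t ^ 2 = a then (1 : ℤ) else 0)
        = if a * (t ^ 2)⁻¹ ∈ T then 1 else 0 := by
      simp only [← eq_mul_inv_iff_mul_eq]
      simp
    rw [e]
    by_cases t1 : t = 1
    · subst t1
      simp [ha, ha1.symm, hai1.symm]
    by_cases ta : t = a
    · subst ta
      have : t * (t ^ 2)⁻¹ = t⁻¹ := by group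
      rw [this]
      have h3 : t ^ 3 ≠ t := by
        intro h
        apply t1; apply aux_sq n T hT
        rw [pow_succ] at h
        simpa using h
      simp [hi, ha1, hai, h3]
    by_cases ti : t = a⁻¹
    · subst ti
      have : a * (a⁻¹ ^ 2)⁻¹ = a ^ 3 := by group
      rw [this]
      have h3 : a⁻¹ ^ 3 ≠ a := by
        intro h
        apply ha1; apply aux_sq n T hT
        apply aux_sq n T hT
        have : a ^ 4 = (a⁻¹ ^ 3)⁻¹ * a := by group
        rw [← pow_mul, this, h]; simp
      rw [if_neg h3]
      simp [ha1, hai.symm]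
    simp only [t1, ta, ti, if_false, add_zero]
    congr 1
    have e : a * (t ^ 2)⁻¹ = t ↔ t ^ 3 = a := by
      rw [mul_inv_eq_iff_eq_mul, ← pow_succ', eq_comm]
    rw [eq_iff_iff, ← e]
    constructor
    · intro hs
      by_contra hne
      have := aux_uniq n T hT hs ht ha ((aux_inv n T hT).2 ht) hne
        (by intro h; exact ti (by rw [h]; simp))
        (by intro h; apply ta; 
            have : a * (t ^ 2)⁻¹ * t = a * t⁻¹ := by group
            rw [this, mul_inv_eq_one] at h; exact h.symm)
        (by group)
      rcases this with ⟨-, h⟩ | ⟨-, h⟩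
      · apply t1; apply aux_sq n T hT
        rw [pow_two]; nth_rewrite 1 [h]; simp
      · exact ta h
    · intro h; rwa [h]
  rw [sum_comm, sum_congr rfl key]
  simp only [sum_add_distrib, sum_ite_eq', h1, ha, hi, if_true]
  ring

lemma aux_m1 (T : Finset G) :
    (∑ g : G, ∑ s ∈ T, ∑ t ∈ T, if s * t ^ 2 = g then (1 : ℤ) else 0) = (#T : ℤ) ^ 2 := by
  rw [sum_comm]
  have : ∀ s ∈ T, (∑ g : G, ∑ t ∈ T, if s * t ^ 2 = g then (1 : ℤ) else 0) = #T := by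
    intro s _
    rw [sum_comm]; simp
  rw [sum_congr rfl this]; simp [pow_two]

lemma aux_suminv (n : ℕ) (T : Finset G) (hT : IsPerfectTilingSubset n T) (f : G → ℤ) :
    ∑ t ∈ T, f t⁻¹ = ∑ t ∈ T, f t := by
  refine sum_equiv (Equiv.inv G) (fun i => ?_) (fun i _ => rfl)
  simp [aux_inv n T hT]

lemma aux_m2 (n : ℕ) (T : Finset G) (hT : IsPerfectTilingSubset n T) :
    (∑ g : G, (∑ s ∈ T, ∑ t ∈ T, if s * t ^ 2 = g then (1 : ℤ) else 0) ^ 2)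
      = 12 * n ^ 2 + 12 * n + ∑ t ∈ T, if t ^ 3 = 1 then (1 : ℤ) else 0 := by
  have hcard : (#T : ℤ) = 2 * n + 1 := by rw [hT.2.1]; push_cast; ring
  have h1 := hT.2.2.1
  -- step 1
  have s1 : (∑ g : G, (∑ s ∈ T, ∑ t ∈ T, if s * t ^ 2 = g then (1 : ℤ) else 0) ^ 2)
      = ∑ s ∈ T, ∑ t ∈ T, ∑ s' ∈ T, ∑ t' ∈ T, if s * t ^ 2 = s' * t' ^ 2 then (1 : ℤ) else 0 := by
    simp only [pow_two (∑ s ∈ T, ∑ t ∈ T, _), sum_mul]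
    rw [sum_comm]
    refine sum_congr rfl fun s _ => ?_
    rw [sum_comm]
    refine sum_congr rfl fun t _ => ?_
    simp only [ite_mul, one_mul, zero_mul]
    rw [sum_ite_eq]
    simp only [mem_univ, if_true]
    refine sum_congr rfl fun s _ => sum_congr rfl fun t _ => ?_
    simp only [eq_comm]
  have s2 : (∑ s ∈ T, ∑ t ∈ T, ∑ s' ∈ T, ∑ t' ∈ T, if s * t ^ 2 = s' * t' ^ 2 then (1 : ℤ) else 0)
      = ∑ t ∈ T, ∑ t' ∈ T, ∑ s ∈ T, ∑ s' ∈ T, if s * s' = (t * t') ^ 2 then (1 : ℤ) else 0 := by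
    rw [sum_comm, ← aux_suminv n T hT]
    refine sum_congr rfl fun t _ => ?_
    conv_rhs => rw [sum_comm]
    refine sum_congr rfl fun s _ => ?_
    rw [← aux_suminv n T hT, sum_comm]
    refine sum_congr rfl fun t' _ => sum_congr rfl fun s' _ => ?_
    congr 1
    rw [eq_iff_iff, mul_pow, inv_pow, mul_inv_eq_iff_eq_mul, mul_assoc, eq_inv_mul_iff_mul_eq,
      mul_comm s' s, mul_comm (t' ^ 2)]
  have s3 : ∀ y : G, (∑ s ∈ T, ∑ s' ∈ T, if s * s' = y ^ 2 then (1 : ℤ) else 0)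
      = 2 + (if y ∈ T then 1 else 0) + if y = 1 then 2 * (n : ℤ) - 2 else 0 := by
    intro y
    rw [aux_r n T hT]
    have e1 : ∀ t, t ^ 2 = y ^ 2 ↔ t = y := fun t => ⟨aux_sq n T hT, fun h => by rw [h]⟩
    have e2 : y ^ 2 = 1 ↔ y = 1 := ⟨fun h => aux_sq n T hT (by simpa using h), fun h => by simp [h]⟩
    simp [e1, e2]
  have s4 : (∑ t ∈ T, ∑ t' ∈ T, if t * t' ∈ T then (1 : ℤ) else 0)
      = 2 * #T + (∑ t ∈ T, if t ^ 3 = 1 then (1 : ℤ) else 0) + (2 * n - 2) := by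
    have e : ∀ t ∈ T, ∀ t' ∈ T, (if t * t' ∈ T then (1 : ℤ) else 0)
        = ∑ x ∈ T, if t * t' = x then (1 : ℤ) else 0 := by
      intro t _ t' _
      simp
    rw [sum_congr rfl fun t ht => sum_congr rfl (e t ht)]
    have e' : (∑ t ∈ T, ∑ t' ∈ T, ∑ x ∈ T, if t * t' = x then (1 : ℤ) else 0)
      = ∑ x ∈ T, ∑ t ∈ T, ∑ t' ∈ T, if t * t' = x then (1 : ℤ) else 0 := by
      conv_rhs => rw [sum_comm]
      refine sum_congr rfl fun t _ => ?_
      rw [sum_comm]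
    rw [e', sum_congr rfl fun x _ => aux_r n T hT x]
    simp only [sum_add_distrib, sum_ite_eq', h1, if_true, sum_const, nsmul_eq_mul]
    rw [sum_comm]
    have : ∀ t ∈ T, (∑ x ∈ T, if t ^ 2 = x then (1 : ℤ) else 0) = if t ^ 3 = 1 then 1 else 0 := by
      intro t ht
      simp [aux_sqT n T hT ht]
    rw [sum_congr rfl this]
    ring
  have s5 : (∑ t ∈ T, ∑ t' ∈ T, if t * t' = 1 then 2 * (n : ℤ) - 2 else 0)
      = #T * (2 * n - 2) := by
    have : ∀ t ∈ T, (∑ t' ∈ T, if t * t' = 1 then 2 * (n : ℤ) - 2 else 0) = 2 * n - 2 := by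
      intro t ht
      have e : ∀ t', t * t' = 1 ↔ t' = t⁻¹ := fun t' => by
        rw [mul_eq_one_iff_eq_inv']
      simp [e, aux_inv n T hT, ht]
    rw [sum_congr rfl this, sum_const, nsmul_eq_mul]
  rw [s1, s2]
  simp only [s3, sum_add_distrib, s4, s5, sum_const, nsmul_eq_mul, hcard]
  ring

end aux

theorem stmt7 (n : ℕ) (hn : 3 ≤ n) (hmod : n % 3 = 1)
    {G : Type} [CommGroup G] [Fintype G] [DecidableEq G]
    (T : Finset G) (hT : IsPerfectTilingSubset n T) :
    ∀ g : G, (T.filter (fun t => t ^ 3 = g)).card ≤ 2 := by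
  exfalso
  have hcard : (T.card : ℤ) = 2 * n + 1 := by rw [hT.2.1]; push_cast; ring
  have m1 := aux_m1 T
  have m2 := aux_m2 n T hT
  have i1 := aux_i1 n T hT
  set i : G → ℤ := fun g => ∑ s ∈ T, ∑ t ∈ T, if s * t ^ 2 = g then (1 : ℤ) else 0 with hi
  set c : G → ℤ := fun g => ∑ t ∈ T, if t ^ 3 = g then (1 : ℤ) else 0 with hc
  have hc0 : ∀ g, 0 ≤ c g := fun g => Finset.sum_nonneg fun t _ => by split_ifs <;> simp
  have hi0 : ∀ g, 0 ≤ i g := fun g => Finset.sum_nonneg fun t _ =>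
    Finset.sum_nonneg fun t _ => by split_ifs <;> simp
  have hic : ∀ g, ∃ w : ℤ, i g = c g + 3 * w := aux_i n hmod T hT
  have cube : ∀ a ∈ T, a ^ 3 ∈ T := by
    intro a ha
    by_cases h1 : a = 1
    · subst h1; simpa using ha
    by_contra h3
    have h := aux_ia n T hT ha h1
    rw [if_neg h3] at h
    obtain ⟨w, hw⟩ := hic a
    change i a = c a + 2 + 0 at h
    omega
  have hia : ∀ a ∈ T, a ≠ 1 → i a = c a + 3 := by
    intro a ha h1
    have h := aux_ia n T hT ha h1
    rw [if_pos (cube a ha)] at h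
    change i a = c a + 2 + 1 at h
    omega
  have hsc : ∑ g, c g = 2 * n + 1 := by
    rw [hc, Finset.sum_comm]; simp [hcard]
  have hout : ∀ g, g ∉ T → c g = 0 := by
    intro g hg
    refine Finset.sum_eq_zero fun t ht => if_neg ?_
    rintro rfl
    exact hg (cube t ht)
  have hpt : ∀ g, g ≠ 1 → 3 * c g ≤ i g ^ 2 - 3 * i g := by
    intro g hg
    by_cases h : g ∈ T
    · rw [hia g h hg]; nlinarith [hc0 g]
    · rw [hout g h]
      obtain ⟨w, hw⟩ := hic g
      rw [hout g h] at hw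
      have := hi0 g
      have hw0 : 0 ≤ w := by omega
      rw [hw]
      rcases hw0.eq_or_lt with h | h
      · rw [← h]; simp
      · nlinarith
  have m1' : ∑ g, i g = (2 * n + 1 : ℤ) ^ 2 := by rw [← hcard]; exact m1
  have m2' : ∑ g, i g ^ 2 = 12 * n ^ 2 + 12 * n + c 1 := m2
  have i1' : i 1 = c 1 := i1
  have hs : ∑ g ∈ Finset.univ.erase (1 : G), 3 * c g
      ≤ ∑ g ∈ Finset.univ.erase (1 : G), (i g ^ 2 - 3 * i g) :=
    Finset.sum_le_sum fun g hg => hpt g (Finset.ne_of_mem_erase hg)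
  have e1 := Finset.add_sum_erase Finset.univ (fun g => 3 * c g) (Finset.mem_univ (1 : G))
  have e2 := Finset.add_sum_erase Finset.univ (fun g => i g ^ 2 - 3 * i g)
    (Finset.mem_univ (1 : G))
  simp only [Finset.sum_sub_distrib, ← Finset.mul_sum] at e1 e2 hs
  rw [hsc] at e1
  rw [m1', m2', i1'] at e2
  have hn' : (3 : ℤ) ≤ n := by exact_mod_cast hn
  nlinarith [sq_nonneg (2 * c 1 - 7)]
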